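/- Let Ψ₁, Ψ₂ : C⊗D → D⊗C be twist maps satisfying condition (CO), and let θ : C⊗D → C⊗D be a coalgebra automorphism of the tensor coalgebra (C⊗D, Δ_⊗, ε_⊗) (i.e. a linear bijection with (θ⊗θ)∘Δ_⊗ = Δ_⊗∘θ and ε_⊗∘θ = ε_⊗) such that (id_C⊗Ψ₂'⊗id_D)∘(θ⊗θ) = (θ⊗θ)∘(id_C⊗Ψ₁'⊗id_D), where Ψᵢ' := Ψᵢ∘τ. Then (θ⊗θ)∘Δ_{Ψ₁} = Δ_{Ψ₂}∘θ; moreover, if e₁ and e₂ are counits for Δ_{Ψ₁} and Δ_{Ψ₂} respectively, then e₂∘θ = e₁, so that θ is a coalgebra isomorphism from (C⊗D, Δ_{Ψ₁}, e₁) to (C⊗D, Δ_{Ψ₂}, e₂). -/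

import Mathlib

open TensorProduct LinearMap

noncomputable section
namespace TwistedTensor

/-- The coproduct of a coalgebra, with explicit arguments. -/
def cmul (k C : Type*) [CommSemiring k] [AddCommMonoid C] [Module k C] [Coalgebra k C] :
    C →ₗ[k] C ⊗[k] C := Coalgebra.comul

/-- The counit of a coalgebra, with explicit arguments. -/
def eps (k C : Type*) [CommSemiring k] [AddCommMonoid C] [Module k C] [Coalgebra k C] :
    C →ₗ[k] k := Coalgebra.counit

variable {k : Type*} [Field k]
variable {C D : Type*} [AddCommGroup C] [Module k C] [AddCommGroup D] [Module k D]
  [Coalgebra k C] [Coalgebra k D]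

/-- The twisted coproduct `Δ_Ψ := (id_C ⊗ Ψ ⊗ id_D) ∘ (Δ_C ⊗ Δ_D)` (with the
appropriate reassociations of tensor factors). -/
def twistedComul (Ψ : C ⊗[k] D →ₗ[k] D ⊗[k] C) :
    C ⊗[k] D →ₗ[k] (C ⊗[k] D) ⊗[k] (C ⊗[k] D) :=
  (TensorProduct.assoc k C D (C ⊗[k] D)).symm.toLinearMap
    ∘ₗ lTensor C (TensorProduct.assoc k D C D).toLinearMap
    ∘ₗ lTensor C (rTensor D Ψ)
    ∘ₗ lTensor C (TensorProduct.assoc k C D D).symm.toLinearMap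
    ∘ₗ (TensorProduct.assoc k C C (D ⊗[k] D)).toLinearMap
    ∘ₗ map (cmul k C) (cmul k D)

/-- Left-hand side of condition (CO):
`(id_D⊗id_C⊗Ψ)∘(id_D⊗Δ_C⊗id_D)∘(Ψ⊗id_D)∘(id_C⊗Δ_D)`. -/
def COlhs (Ψ : C ⊗[k] D →ₗ[k] D ⊗[k] C) :
    C ⊗[k] D →ₗ[k] D ⊗[k] (C ⊗[k] (D ⊗[k] C)) :=
  lTensor D ((lTensor C Ψ) ∘ₗ (TensorProduct.assoc k C C D).toLinearMap)
    ∘ₗ lTensor D (rTensor D (cmul k C))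
    ∘ₗ (TensorProduct.assoc k D C D).toLinearMap
    ∘ₗ rTensor D Ψ
    ∘ₗ (TensorProduct.assoc k C D D).symm.toLinearMap
    ∘ₗ lTensor C (cmul k D)

/-- Right-hand side of condition (CO):
`(Ψ⊗id_D⊗id_C)∘(id_C⊗Δ_D⊗id_C)∘(id_C⊗Ψ)∘(Δ_C⊗id_D)`. -/
def COrhs (Ψ : C ⊗[k] D →ₗ[k] D ⊗[k] C) :
    C ⊗[k] D →ₗ[k] D ⊗[k] (C ⊗[k] (D ⊗[k] C)) :=
  (TensorProduct.assoc k D C (D ⊗[k] C)).toLinearMap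
    ∘ₗ rTensor (D ⊗[k] C) Ψ
    ∘ₗ (TensorProduct.assoc k C D (D ⊗[k] C)).symm.toLinearMap
    ∘ₗ lTensor C (TensorProduct.assoc k D D C).toLinearMap
    ∘ₗ lTensor C (rTensor C (cmul k D))
    ∘ₗ lTensor C Ψ
    ∘ₗ (TensorProduct.assoc k C C D).toLinearMap
    ∘ₗ rTensor D (cmul k C)

/-- Condition (CO) on a twist map. -/
def CondCO (Ψ : C ⊗[k] D →ₗ[k] D ⊗[k] C) : Prop := COlhs Ψ = COrhs Ψ

/-- The tensor counit `ε_⊗ = ε_C ⊗ ε_D`. -/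
def tensorCounit : C ⊗[k] D →ₗ[k] k :=
  (TensorProduct.lid k k).toLinearMap ∘ₗ map (eps k C) (eps k D)

/-- `e` is a counit for the coproduct `δ` on `C ⊗ D`. -/
def IsCounit (δ : C ⊗[k] D →ₗ[k] (C ⊗[k] D) ⊗[k] (C ⊗[k] D))
    (e : C ⊗[k] D →ₗ[k] k) : Prop :=
  (TensorProduct.lid k (C ⊗[k] D)).toLinearMap ∘ₗ rTensor (C ⊗[k] D) e ∘ₗ δ = LinearMap.id ∧
  (TensorProduct.rid k (C ⊗[k] D)).toLinearMap ∘ₗ lTensor (C ⊗[k] D) e ∘ₗ δ = LinearMap.id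

/-- Right conormality: `(ε_D⊗id_C)∘Ψ = id_C⊗ε_D`. -/
def RightConormal (Ψ : C ⊗[k] D →ₗ[k] D ⊗[k] C) : Prop :=
  (TensorProduct.lid k C).toLinearMap ∘ₗ rTensor C (eps k D) ∘ₗ Ψ
    = (TensorProduct.rid k C).toLinearMap ∘ₗ lTensor C (eps k D)

/-- Left conormality: `(id_D⊗ε_C)∘Ψ = ε_C⊗id_D`. -/
def LeftConormal (Ψ : C ⊗[k] D →ₗ[k] D ⊗[k] C) : Prop :=
  (TensorProduct.rid k D).toLinearMap ∘ₗ lTensor D (eps k C) ∘ₗ Ψ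
    = (TensorProduct.lid k D).toLinearMap ∘ₗ rTensor D (eps k C)

/-- Conormality of a twist map. -/
def Conormal (Ψ : C ⊗[k] D →ₗ[k] D ⊗[k] C) : Prop :=
  RightConormal Ψ ∧ LeftConormal Ψ

/-- Condition (CP1): `(id_D⊗Ψ)∘(Ψ⊗id_D)∘(id_C⊗Δ_D) = (Δ_D⊗id_C)∘Ψ`. -/
def CP1 (Ψ : C ⊗[k] D →ₗ[k] D ⊗[k] C) : Prop :=
  lTensor D Ψ ∘ₗ (TensorProduct.assoc k D C D).toLinearMap ∘ₗ rTensor D Ψ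
      ∘ₗ (TensorProduct.assoc k C D D).symm.toLinearMap ∘ₗ lTensor C (cmul k D)
    = (TensorProduct.assoc k D D C).toLinearMap ∘ₗ rTensor C (cmul k D) ∘ₗ Ψ

/-- Condition (CP2): `(Ψ⊗id_C)∘(id_C⊗Ψ)∘(Δ_C⊗id_D) = (id_D⊗Δ_C)∘Ψ`. -/
def CP2 (Ψ : C ⊗[k] D →ₗ[k] D ⊗[k] C) : Prop :=
  (TensorProduct.assoc k D C C).toLinearMap ∘ₗ rTensor C Ψ
      ∘ₗ (TensorProduct.assoc k C D C).symm.toLinearMap ∘ₗ lTensor C Ψ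
      ∘ₗ (TensorProduct.assoc k C C D).toLinearMap ∘ₗ rTensor D (cmul k C)
    = lTensor D (cmul k C) ∘ₗ Ψ

/-- The functional `ε_Z := (ε_D⊗ε_C)∘Z`. -/
def epsZ (Z : C ⊗[k] D →ₗ[k] D ⊗[k] C) : C ⊗[k] D →ₗ[k] k :=
  (TensorProduct.lid k k).toLinearMap ∘ₗ map (eps k D) (eps k C) ∘ₗ Z

/-- Right `Z`-conormality: `(ε_Z⊗id_C)∘(id_C⊗Ψ)∘(Δ_C⊗id_D) = id_C⊗ε_D`. -/
def RightZConormal (Ψ Z : C ⊗[k] D →ₗ[k] D ⊗[k] C) : Prop :=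
  (TensorProduct.lid k C).toLinearMap ∘ₗ rTensor C (epsZ Z)
      ∘ₗ (TensorProduct.assoc k C D C).symm.toLinearMap ∘ₗ lTensor C Ψ
      ∘ₗ (TensorProduct.assoc k C C D).toLinearMap ∘ₗ rTensor D (cmul k C)
    = (TensorProduct.rid k C).toLinearMap ∘ₗ lTensor C (eps k D)

/-- Left `Z`-conormality: `(id_D⊗ε_Z)∘(Ψ⊗id_D)∘(id_C⊗Δ_D) = ε_C⊗id_D`. -/
def LeftZConormal (Ψ Z : C ⊗[k] D →ₗ[k] D ⊗[k] C) : Prop :=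
  (TensorProduct.rid k D).toLinearMap ∘ₗ lTensor D (epsZ Z)
      ∘ₗ (TensorProduct.assoc k D C D).toLinearMap ∘ₗ rTensor D Ψ
      ∘ₗ (TensorProduct.assoc k C D D).symm.toLinearMap ∘ₗ lTensor C (cmul k D)
    = (TensorProduct.lid k D).toLinearMap ∘ₗ rTensor D (eps k C)

/-- `Z`-conormality. -/
def ZConormal (Ψ Z : C ⊗[k] D →ₗ[k] D ⊗[k] C) : Prop :=
  RightZConormal Ψ Z ∧ LeftZConormal Ψ Z

/-- The projection `p_C := (id_C⊗e)∘(Δ_C⊗id_D)`. -/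
def pC (e : C ⊗[k] D →ₗ[k] k) : C ⊗[k] D →ₗ[k] C :=
  (TensorProduct.rid k C).toLinearMap ∘ₗ lTensor C e
    ∘ₗ (TensorProduct.assoc k C C D).toLinearMap ∘ₗ rTensor D (cmul k C)

/-- The projection `p_D := (e⊗id_D)∘(id_C⊗Δ_D)`. -/
def pD (e : C ⊗[k] D →ₗ[k] k) : C ⊗[k] D →ₗ[k] D :=
  (TensorProduct.lid k D).toLinearMap ∘ₗ rTensor D e
    ∘ₗ (TensorProduct.assoc k C D D).symm.toLinearMap ∘ₗ lTensor C (cmul k D)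

/-- The projection `π_C = id_C ⊗ ε_D`. -/
def piC : C ⊗[k] D →ₗ[k] C :=
  (TensorProduct.rid k C).toLinearMap ∘ₗ lTensor C (eps k D)

/-- The projection `π_D = ε_C ⊗ id_D`. -/
def piD : C ⊗[k] D →ₗ[k] D :=
  (TensorProduct.lid k D).toLinearMap ∘ₗ rTensor D (eps k C)

/-- Convolution product on `(C⊗D)'`: `(φ∗φ')(c⊗d) = φ(c₁⊗d₁)φ'(c₂⊗d₂)`. -/
def convMul (φ φ' : C ⊗[k] D →ₗ[k] k) : C ⊗[k] D →ₗ[k] k :=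
  (TensorProduct.lid k k).toLinearMap ∘ₗ map φ φ'
    ∘ₗ (tensorTensorTensorComm k C C D D).toLinearMap
    ∘ₗ map (cmul k C) (cmul k D)

/-- `⋆`-product on `(C⊗D)'`: `(φ⋆φ')(c⊗d) = φ(c₂⊗d₁)φ'(c₁⊗d₂)`. -/
def starMul (φ φ' : C ⊗[k] D →ₗ[k] k) : C ⊗[k] D →ₗ[k] k :=
  (TensorProduct.lid k k).toLinearMap ∘ₗ map φ φ'
    ∘ₗ (tensorTensorTensorComm k C C D D).toLinearMap
    ∘ₗ rTensor (D ⊗[k] D) (TensorProduct.comm k C C).toLinearMap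
    ∘ₗ map (cmul k C) (cmul k D)

/-- Condition (LC1): `(Δ_D⊗id_C)∘Ψ' = (id_D⊗Ψ')∘(Δ_D⊗id_C)`. -/
def LC1 (Ψ' : D ⊗[k] C →ₗ[k] D ⊗[k] C) : Prop :=
  (TensorProduct.assoc k D D C).toLinearMap ∘ₗ rTensor C (cmul k D) ∘ₗ Ψ'
    = lTensor D Ψ' ∘ₗ (TensorProduct.assoc k D D C).toLinearMap ∘ₗ rTensor C (cmul k D)

/-- Condition (LC2): `(id_D⊗Δ_C)∘Ψ' = (Ψ'⊗id_C)∘(id_D⊗Δ_C)`. -/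
def LC2 (Ψ' : D ⊗[k] C →ₗ[k] D ⊗[k] C) : Prop :=
  lTensor D (cmul k C) ∘ₗ Ψ'
    = (TensorProduct.assoc k D C C).toLinearMap ∘ₗ rTensor C Ψ'
        ∘ₗ (TensorProduct.assoc k D C C).symm.toLinearMap ∘ₗ lTensor D (cmul k C)

/-- `Ψ' := Ψ ∘ τ`. -/
def psiPrime (Ψ : C ⊗[k] D →ₗ[k] D ⊗[k] C) : D ⊗[k] C →ₗ[k] D ⊗[k] C :=
  Ψ ∘ₗ (TensorProduct.comm k D C).toLinearMap

/-- The twist `Ψ'_φ : d⊗c ↦ φ(c₁⊗d₂) d₁⊗c₂` associated to a functional `φ`. -/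
def PsiPhi (φ : C ⊗[k] D →ₗ[k] k) : D ⊗[k] C →ₗ[k] D ⊗[k] C :=
  (TensorProduct.rid k (D ⊗[k] C)).toLinearMap
    ∘ₗ lTensor (D ⊗[k] C) φ
    ∘ₗ lTensor (D ⊗[k] C) (TensorProduct.comm k D C).toLinearMap
    ∘ₗ (tensorTensorTensorComm k D D C C).toLinearMap
    ∘ₗ lTensor (D ⊗[k] D) (TensorProduct.comm k C C).toLinearMap
    ∘ₗ map (cmul k D) (cmul k C)

/-- The functional `F(Ψ') := (ε_D⊗ε_C)∘Ψ'∘τ` associated to a twist `Ψ' : D⊗C → D⊗C`. -/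
def Ffun (Ψ' : D ⊗[k] C →ₗ[k] D ⊗[k] C) : C ⊗[k] D →ₗ[k] k :=
  (TensorProduct.lid k k).toLinearMap ∘ₗ map (eps k D) (eps k C) ∘ₗ Ψ'
    ∘ₗ (TensorProduct.comm k C D).toLinearMap

/-- The tensor product coproduct `Δ_⊗` on `C ⊗ D`. -/
def tensorComul : C ⊗[k] D →ₗ[k] (C ⊗[k] D) ⊗[k] (C ⊗[k] D) :=
  (tensorTensorTensorComm k C C D D).toLinearMap ∘ₗ map (cmul k C) (cmul k D)

/-- The map `id_C ⊗ Ψ' ⊗ id_D : (C⊗D)⊗(C⊗D) → (C⊗D)⊗(C⊗D)`. -/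
def midMap (Ψ' : D ⊗[k] C →ₗ[k] D ⊗[k] C) :
    (C ⊗[k] D) ⊗[k] (C ⊗[k] D) →ₗ[k] (C ⊗[k] D) ⊗[k] (C ⊗[k] D) :=
  (TensorProduct.assoc k C D (C ⊗[k] D)).symm.toLinearMap
    ∘ₗ lTensor C ((TensorProduct.assoc k D C D).toLinearMap ∘ₗ rTensor D Ψ'
        ∘ₗ (TensorProduct.assoc k D C D).symm.toLinearMap)
    ∘ₗ (TensorProduct.assoc k C D (C ⊗[k] D)).toLinearMap

/-- `C` is co-commutative up to isomorphism: there is a coalgebra isomorphism `C ≅ C^cop`. -/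
def CocommUpToIso (k C : Type*) [CommSemiring k] [AddCommMonoid C] [Module k C]
    [Coalgebra k C] : Prop :=
  ∃ χ : C →ₗ[k] C, Function.Bijective χ ∧
    map χ χ ∘ₗ cmul k C = (TensorProduct.comm k C C).toLinearMap ∘ₗ cmul k C ∘ₗ χ ∧
    eps k C ∘ₗ χ = eps k C

theorem twistedComul_eq_midMap_comp_tensorComul (Ψ : C ⊗[k] D →ₗ[k] D ⊗[k] C) :
    twistedComul Ψ = midMap (psiPrime Ψ) ∘ₗ tensorComul := by
  have key : (TensorProduct.assoc k C D (C ⊗[k] D)).symm.toLinearMap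
      ∘ₗ lTensor C (TensorProduct.assoc k D C D).toLinearMap
      ∘ₗ lTensor C (rTensor D Ψ)
      ∘ₗ lTensor C (TensorProduct.assoc k C D D).symm.toLinearMap
      ∘ₗ (TensorProduct.assoc k C C (D ⊗[k] D)).toLinearMap
      = midMap (psiPrime Ψ) ∘ₗ (tensorTensorTensorComm k C C D D).toLinearMap := by
    ext a b c d
    simp [midMap, psiPrime]
  simpa only [twistedComul, tensorComul, comp_assoc] using
    congrArg (· ∘ₗ map (cmul k C) (cmul k D)) key

/-- A left counit and a right counit for the same coproduct coincide. -/
theorem leftCounit_eq_rightCounit {V : Type*} [AddCommGroup V] [Module k V]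
    {δ : V →ₗ[k] V ⊗[k] V}
    {f e : V →ₗ[k] k}
    (hf : (TensorProduct.lid k V).toLinearMap ∘ₗ rTensor V f ∘ₗ δ
      = LinearMap.id)
    (he : (TensorProduct.rid k V).toLinearMap ∘ₗ lTensor V e ∘ₗ δ
      = LinearMap.id) : f = e := by
  have key : f ∘ₗ (TensorProduct.rid k V).toLinearMap ∘ₗ lTensor V e
      = e ∘ₗ (TensorProduct.lid k V).toLinearMap ∘ₗ rTensor V f :=
    TensorProduct.ext' fun x y => by simp [mul_comm]
  calc f = f ∘ₗ (TensorProduct.rid k V).toLinearMap ∘ₗ lTensor V e ∘ₗ δ := by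
        rw [he, comp_id]
    _ = e ∘ₗ (TensorProduct.lid k V).toLinearMap ∘ₗ rTensor V f ∘ₗ δ := by
        simpa only [comp_assoc] using congrArg (· ∘ₗ δ) key
    _ = e := by rw [hf, comp_id]

/-- A left counit pulls back along an injective map compatible with the coproducts. -/
theorem leftCounit_comp {V : Type*} [AddCommGroup V] [Module k V]
    {δ₁ δ₂ : V →ₗ[k] V ⊗[k] V}
    {θ : V →ₗ[k] V} (hθ : Function.Injective θ)
    (h : map θ θ ∘ₗ δ₁ = δ₂ ∘ₗ θ) {e : V →ₗ[k] k}
    (he : (TensorProduct.lid k V).toLinearMap ∘ₗ rTensor V e ∘ₗ δ₂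
      = LinearMap.id) :
    (TensorProduct.lid k V).toLinearMap ∘ₗ rTensor V (e ∘ₗ θ) ∘ₗ δ₁
      = LinearMap.id := by
  have key : θ ∘ₗ (TensorProduct.lid k V).toLinearMap
        ∘ₗ rTensor V (e ∘ₗ θ)
      = (TensorProduct.lid k V).toLinearMap ∘ₗ rTensor V e ∘ₗ map θ θ :=
    TensorProduct.ext' fun x y => by simp
  refine (LinearMap.cancel_left hθ).1 ?_
  calc θ ∘ₗ (TensorProduct.lid k V).toLinearMap
        ∘ₗ rTensor V (e ∘ₗ θ) ∘ₗ δ₁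
      = (TensorProduct.lid k V).toLinearMap
        ∘ₗ rTensor V e ∘ₗ map θ θ ∘ₗ δ₁ := by
        simpa only [comp_assoc] using congrArg (· ∘ₗ δ₁) key
    _ = θ ∘ₗ LinearMap.id := by
        rw [h, comp_id]
        simpa only [comp_assoc, id_comp] using congrArg (· ∘ₗ θ) he

theorem stmt18 (Ψ1 Ψ2 : C ⊗[k] D →ₗ[k] D ⊗[k] C) (h1 : CondCO Ψ1) (h2 : CondCO Ψ2)
    (θ : C ⊗[k] D →ₗ[k] C ⊗[k] D) (hbij : Function.Bijective θ)
    (hcomul : map θ θ ∘ₗ tensorComul = tensorComul ∘ₗ θ)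
    (hcounit : tensorCounit ∘ₗ θ = tensorCounit)
    (hint : midMap (psiPrime Ψ2) ∘ₗ map θ θ = map θ θ ∘ₗ midMap (psiPrime Ψ1)) :
    map θ θ ∘ₗ twistedComul Ψ1 = twistedComul Ψ2 ∘ₗ θ ∧
    ∀ e1 e2 : C ⊗[k] D →ₗ[k] k,
      IsCounit (twistedComul Ψ1) e1 → IsCounit (twistedComul Ψ2) e2 → e2 ∘ₗ θ = e1 := by
  have h : map θ θ ∘ₗ twistedComul Ψ1 = twistedComul Ψ2 ∘ₗ θ := by
    rw [twistedComul_eq_midMap_comp_tensorComul, twistedComul_eq_midMap_comp_tensorComul,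
      ← comp_assoc, ← hint, comp_assoc, hcomul, comp_assoc]
  exact ⟨h, fun e1 e2 he1 he2 =>
    leftCounit_eq_rightCounit (leftCounit_comp hbij.injective h he2.1) he1.2⟩

end TwistedTensor
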